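/- Let B ≥ 1 be an integer, let r < 0, let η ∈ ℝ with η > 0, and let t = j/B for some integer j ∈ {1, ..., B} with η < t. Let F_{r,η} be the set of r-concave probability mass functions f on {0, 1, ..., B} with mean E(f) ≤ η, and let T_t(f) = ∑_{i=j}^B f_i. Suppose f* ∈ F_{r,η} satisfies T_t(f*) ≥ T_t(g) for all g ∈ F_{r,η}, and let i_M = max{i : f*_i > 0}. Then f*_i > 0 for all 0 ≤ i ≤ i_M − 1, and the sequence (f*_i)^r is affine in i on {0, 1, ..., i_M − 1}: for all 0 ≤ i ≤ i_M − 1, (i_M − 1)·(f*_i)^r = (i_M − 1 − i)·(f*_0)^r + i·(f*_{i_M − 1})^r (trivially when i_M ≤ 1). -/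

import Mathlib

/-- A probability mass function on the lattice `{0, 1/B, ..., 1}`, indexed by
`{0, 1, ..., B}` and extended by zero beyond `B`. -/
def LatticePMF (B : ℕ) (f : ℕ → ℝ) : Prop :=
  (∀ i, 0 ≤ f i) ∧ (∀ i, B < i → f i = 0) ∧ ∑ i ∈ Finset.range (B + 1), f i = 1

/-- For `r < 0`, a pmf `f` on `{0, 1, ..., B}` is `r`-concave if for all
`i ≤ j' ≤ k ≤ B` with `f_i > 0` and `f_k > 0`, also `f_{j'} > 0` and
`(k - i) f_{j'}^r ≤ (k - j') f_i^r + (j' - i) f_k^r` (convexity of the linear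
interpolant of `f^r`, with the convention `0^r = ∞`). -/
def RConcavePMF (B : ℕ) (r : ℝ) (f : ℕ → ℝ) : Prop :=
  ∀ i j' k : ℕ, i ≤ j' → j' ≤ k → k ≤ B → 0 < f i → 0 < f k →
    0 < f j' ∧
      ((k : ℝ) - i) * f j' ^ r ≤ ((k : ℝ) - j') * f i ^ r + ((j' : ℝ) - i) * f k ^ r

/-- The mean `E(f) = ∑_{i=0}^B (i/B) f_i` of a pmf on `{0, 1/B, ..., 1}`. -/
noncomputable def pmfMean (B : ℕ) (f : ℕ → ℝ) : ℝ :=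
  ∑ i ∈ Finset.range (B + 1), ((i : ℝ) / B) * f i

/-- The tail probability `T_{j/B}(f) = ∑_{i=j}^B f_i`. -/
noncomputable def pmfTail (B j : ℕ) (f : ℕ → ℝ) : ℝ :=
  ∑ i ∈ Finset.Icc j B, f i

open Filter Topology

/-- Convexity of a real sequence on the integer interval `[a, b]`. -/
def SeqConvexOn (a b : ℕ) (ψ : ℕ → ℝ) : Prop :=
  ∀ i l k : ℕ, a ≤ i → i ≤ l → l ≤ k → k ≤ b →
    ((k : ℝ) - i) * ψ l ≤ ((k : ℝ) - l) * ψ i + ((l : ℝ) - i) * ψ k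

/-- The weight `1_{i ≥ j} - T` whose pairing with a mass function compares its tail with `T`. -/
noncomputable def tailWeight (j : ℕ) (T : ℝ) (i : ℕ) : ℝ := (if j ≤ i then 1 else 0) - T

/-- Scale-invariant form of maximality of the tail probability `T` under the constraint
that the index mean is at most `m`. -/
def TailMaximal (B j : ℕ) (r m T : ℝ) : Prop :=
  ∀ h : ℕ → ℝ, (∀ i, 0 ≤ h i) → (∀ i, B < i → h i = 0) → RConcavePMF B r h →
    ∑ i ∈ Finset.range (B + 1), ((i : ℝ) - m) * h i ≤ 0 →
    ∑ i ∈ Finset.range (B + 1), tailWeight j T i * h i ≤ 0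

lemma sum_tailWeight_mul (B j : ℕ) (T : ℝ) (h : ℕ → ℝ) :
    ∑ i ∈ Finset.range (B + 1), tailWeight j T i * h i =
      pmfTail B j h - T * ∑ i ∈ Finset.range (B + 1), h i := by
  have hI : Finset.Icc j B = (Finset.range (B + 1)).filter (fun i => j ≤ i) := by
    ext i; simp; omega
  simp only [tailWeight, pmfTail, sub_mul, Finset.sum_sub_distrib, Finset.mul_sum, hI,
    Finset.sum_filter, ite_mul, one_mul, zero_mul]

lemma sum_sub_mul (B : ℕ) (hB : 1 ≤ B) (η : ℝ) (h : ℕ → ℝ) :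
    ∑ i ∈ Finset.range (B + 1), ((i : ℝ) - B * η) * h i =
      B * (pmfMean B h - η * ∑ i ∈ Finset.range (B + 1), h i) := by
  have hB0 : (B : ℝ) ≠ 0 := by positivity
  simp only [pmfMean, mul_sub, Finset.mul_sum, ← Finset.sum_sub_distrib]
  refine Finset.sum_congr rfl fun i _ => ?_
  field_simp

lemma RConcavePMF.const_mul {B : ℕ} {r c : ℝ} {h : ℕ → ℝ} (hh : RConcavePMF B r h)
    (h0 : ∀ i, 0 ≤ h i) (hc : 0 < c) : RConcavePMF B r (fun i => c * h i) := by
  intro i l k hil hlk hk hi hkk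
  obtain ⟨hl, hle⟩ := hh i l k hil hlk hk ((pos_iff_pos_of_mul_pos hi).1 hc)
    ((pos_iff_pos_of_mul_pos hkk).1 hc)
  refine ⟨mul_pos hc hl, ?_⟩
  simp only [Real.mul_rpow hc.le (h0 _)]
  nlinarith [mul_le_mul_of_nonneg_left hle (Real.rpow_nonneg hc.le r)]

lemma tailMaximal_of_isMax {B j : ℕ} (hB : 1 ≤ B) {r η : ℝ} {f : ℕ → ℝ}
    (hmax : ∀ g : ℕ → ℝ, LatticePMF B g → RConcavePMF B r g → pmfMean B g ≤ η →
      pmfTail B j g ≤ pmfTail B j f) :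
    TailMaximal B j r (B * η) (pmfTail B j f) := by
  intro h h0 hz hr hm
  rw [sum_sub_mul B hB] at hm
  rw [sum_tailWeight_mul]
  have hB0 : (0 : ℝ) < B := by positivity
  have hm' : pmfMean B h - η * ∑ i ∈ Finset.range (B + 1), h i ≤ 0 :=
    nonpos_of_mul_nonpos_right hm hB0
  set Z := ∑ i ∈ Finset.range (B + 1), h i with hZ
  rcases (Finset.sum_nonneg fun i _ => h0 i : 0 ≤ Z).eq_or_lt with hZ0 | hZ0
  · have hall : ∀ i, h i = 0 := by
      intro i
      by_cases hi : i ∈ Finset.range (B + 1)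
      · exact (Finset.sum_eq_zero_iff_of_nonneg fun i _ => h0 i).1 hZ0.symm i hi
      · exact hz i (by simpa using hi)
    have hZ' : Z = 0 := hZ0.symm
    rw [hZ']
    simp [pmfTail, hall]
  · have hg := hmax (fun i => Z⁻¹ * h i)
      ⟨fun i => mul_nonneg (inv_nonneg.2 hZ0.le) (h0 i), fun i hi => by simp [hz i hi],
        by rw [← Finset.mul_sum, ← hZ, inv_mul_cancel₀ hZ0.ne']⟩
      (hr.const_mul h0 (inv_pos.2 hZ0))
      (by
        have : pmfMean B (fun i => Z⁻¹ * h i) = Z⁻¹ * pmfMean B h := by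
          simp only [pmfMean, Finset.mul_sum]
          exact Finset.sum_congr rfl fun i _ => by ring
        rw [this, inv_mul_le_iff₀ hZ0]
        linarith)
    have : pmfTail B j (fun i => Z⁻¹ * h i) = Z⁻¹ * pmfTail B j h := by
      simp only [pmfTail, Finset.mul_sum]
    rw [this, inv_mul_le_iff₀ hZ0] at hg
    linarith

/-- The maximal tail probability is positive. -/
lemma TailMaximal.pos {B j : ℕ} {r m T : ℝ} (hr : r < 0) (hm : 0 < m)
    (hjB : j ≤ B) (hT : 0 ≤ T) (hmax : TailMaximal B j r m T) : 0 < T := by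
  refine hT.lt_of_ne fun hT0 => ?_
  subst hT0
  let h : ℝ → ℕ → ℝ := fun K i => if i ≤ B then (1 + K * i) ^ (1 / r) else 0
  have hlim : ∀ i : ℕ, Tendsto (fun K : ℝ => ((i : ℝ) - m) * h K i) atTop
      (𝓝 (if i = 0 then -m else 0)) := by
    intro i
    rcases Nat.eq_zero_or_pos i with rfl | hi
    · simp [h]
    · rw [if_neg hi.ne']
      by_cases hiB : i ≤ B
      · simp only [h, if_pos hiB]
        have h1 : Tendsto (fun K : ℝ => 1 + K * i) atTop atTop :=
          tendsto_atTop_add_const_left _ _ (tendsto_id.atTop_mul_const (by positivity))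
        have h2 := (tendsto_rpow_neg_atTop (y := -(1 / r))
          (by rw [neg_pos]; exact one_div_neg.2 hr)).comp h1
        simpa using h2.const_mul ((i : ℝ) - m)
      · simp [h, hiB]
  have hsum := tendsto_finsetSum (Finset.range (B + 1)) fun i _ => hlim i
  rw [Finset.sum_ite_eq' (Finset.range (B + 1)) 0 fun _ => -m] at hsum
  simp only [Finset.mem_range, Nat.succ_pos, if_true] at hsum
  obtain ⟨K, hK, hK0⟩ := ((hsum.eventually_lt_const (neg_lt_zero.2 hm)).and
    (eventually_ge_atTop 0)).exists
  have hb : ∀ i : ℕ, 0 < 1 + K * i := fun i => by positivity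
  have hpos : ∀ i ≤ B, 0 < h K i := fun i hi => by
    simp only [h, if_pos hi]; exact Real.rpow_pos_of_pos (hb i) _
  have h0 : ∀ i, 0 ≤ h K i := fun i => by
    by_cases hi : i ≤ B
    · exact (hpos i hi).le
    · simp [h, hi]
  have hle := hmax (h K) h0 (fun i hi => by simp [h, hi]) (by
    intro i l k hil hlk hk _ _
    refine ⟨hpos l (hlk.trans hk), ?_⟩
    simp only [h, if_pos hk, if_pos (hlk.trans hk), if_pos (hil.trans (hlk.trans hk)), one_div,
      Real.rpow_inv_rpow (hb _).le hr.ne]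
    linarith) hK.le
  have : 0 < ∑ i ∈ Finset.range (B + 1), tailWeight j 0 i * h K i := by
    refine Finset.sum_pos' (fun i _ => mul_nonneg ?_ (h0 i)) ⟨j, by simp; omega, ?_⟩
    · simp only [tailWeight]; split_ifs <;> simp
    · simpa [tailWeight] using hpos j hjB
  linarith

/-- The derivative at `0` of the curve that replaces `f ^ r` by `f ^ r + ε ψ` on `[a, b]` and puts
mass `s ε` at `a - 1`. -/
noncomputable def perturbDir (a b : ℕ) (r : ℝ) (f ψ : ℕ → ℝ) (s : ℝ) (i : ℕ) : ℝ :=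
  if a ≤ i ∧ i ≤ b then 1 / r * ((f i ^ r) ^ (1 / r - 1) * ψ i) else if i + 1 = a then s else 0

/-- The curve whose derivative at `0` is `perturbDir`. -/
noncomputable def perturbCurve (a b : ℕ) (r : ℝ) (f ψ : ℕ → ℝ) (s ε : ℝ) (i : ℕ) : ℝ :=
  if a ≤ i ∧ i ≤ b then (f i ^ r + ε * ψ i) ^ (1 / r) else if i + 1 = a then s * ε else 0

lemma hasDerivAt_perturbCurve {a b : ℕ} {r : ℝ} {f ψ : ℕ → ℝ} (s : ℝ)
    (hpos : ∀ i, a ≤ i → i ≤ b → 0 < f i) (i : ℕ) :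
    HasDerivAt (fun ε => perturbCurve a b r f ψ s ε i) (perturbDir a b r f ψ s i) 0 := by
  unfold perturbCurve perturbDir
  split_ifs with h1 h2
  · have hc : 0 < f i ^ r := Real.rpow_pos_of_pos (hpos i h1.1 h1.2) r
    have h : HasDerivAt (fun ε : ℝ => f i ^ r + ε * ψ i) (ψ i) 0 := by
      simpa using ((hasDerivAt_id (0 : ℝ)).mul_const (ψ i)).const_add (f i ^ r)
    have h' := h.rpow_const (p := 1 / r) (Or.inl (by simpa using hc.ne'))
    convert h' using 1
    simp only [zero_mul, add_zero]
    ring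
  · simpa using (hasDerivAt_id (0 : ℝ)).const_mul s
  · exact hasDerivAt_const _ _

lemma perturbCurve_zero {a b : ℕ} {r : ℝ} {f ψ : ℕ → ℝ} (s : ℝ) (hr : r < 0)
    (hpos : ∀ i, a ≤ i → i ≤ b → 0 < f i) (hz : ∀ i, ¬ (a ≤ i ∧ i ≤ b) → f i = 0) (i : ℕ) :
    perturbCurve a b r f ψ s 0 i = f i := by
  unfold perturbCurve
  split_ifs with h1 h2
  · rw [zero_mul, add_zero, one_div, Real.rpow_rpow_inv (hpos i h1.1 h1.2).le hr.ne]
  · rw [hz i h1, mul_zero]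
  · rw [hz i h1]

lemma eventually_rConcave_perturbCurve {a b B : ℕ} {r : ℝ} {f ψ : ℕ → ℝ} {s : ℝ} (hr : r < 0)
    (hpos : ∀ i, a ≤ i → i ≤ b → 0 < f i)
    (hconv : SeqConvexOn a b (fun i => f i ^ r)) (hψ : SeqConvexOn a b ψ) (hs : 0 ≤ s) :
    ∀ᶠ ε in 𝓝[>] (0 : ℝ), (∀ i, 0 ≤ perturbCurve a b r f ψ s ε i) ∧
      RConcavePMF B r (perturbCurve a b r f ψ s ε) := by
  have hφ : ∀ i, a ≤ i → i ≤ b → 0 < f i ^ r := fun i h1 h2 =>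
    Real.rpow_pos_of_pos (hpos i h1 h2) r
  have hcont : ∀ i, Tendsto (fun ε : ℝ => f i ^ r + ε * ψ i) (𝓝[>] 0) (𝓝 (f i ^ r)) := fun i => by
    have : ContinuousAt (fun ε : ℝ => f i ^ r + ε * ψ i) 0 := by fun_prop
    simpa [ContinuousAt] using this.tendsto.mono_left nhdsWithin_le_nhds
  have e1 : ∀ᶠ ε in 𝓝[>] (0 : ℝ), ∀ i ∈ Finset.Icc a b, 0 < f i ^ r + ε * ψ i :=
    (Filter.eventually_all_finset _).2 fun i hi =>
      (hcont i).eventually_const_lt (hφ i (Finset.mem_Icc.1 hi).1 (Finset.mem_Icc.1 hi).2)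
  have e2 : ∀ᶠ ε in 𝓝[>] (0 : ℝ), ∀ i ∈ Finset.Icc a b,
      0 < s → B * (f i ^ r + ε * ψ i) ≤ (s * ε) ^ r := by
    refine (Filter.eventually_all_finset _).2 fun i _ => ?_
    rcases hs.eq_or_lt with rfl | hs
    · simp
    have h1 : Tendsto (fun ε : ℝ => s ^ r * ε ^ r) (𝓝[>] 0) atTop :=
      (tendsto_rpow_neg_nhdsGT_zero hr).const_mul_atTop (Real.rpow_pos_of_pos hs r)
    filter_upwards [((hcont i).const_mul (B : ℝ)).eventually_lt_const (lt_add_one _),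
      h1.eventually_ge_atTop (B * f i ^ r + 1), self_mem_nhdsWithin] with ε h2 h3 h4 _
    rw [Real.mul_rpow hs.le (le_of_lt h4)]
    linarith
  filter_upwards [e1, e2, self_mem_nhdsWithin] with ε h1 h2 hε
  replace hε : 0 < ε := hε
  have hin : ∀ i, a ≤ i → i ≤ b → 0 < perturbCurve a b r f ψ s ε i ∧
      perturbCurve a b r f ψ s ε i ^ r = f i ^ r + ε * ψ i := fun i ha hb => by
    have := h1 i (Finset.mem_Icc.2 ⟨ha, hb⟩)
    rw [perturbCurve, if_pos ⟨ha, hb⟩]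
    exact ⟨Real.rpow_pos_of_pos this _, by rw [one_div, Real.rpow_inv_rpow this.le hr.ne]⟩
  refine ⟨fun i => ?_, ?_⟩
  · by_cases hi : a ≤ i ∧ i ≤ b
    · exact (hin i hi.1 hi.2).1.le
    · rw [perturbCurve, if_neg hi]
      split_ifs <;> positivity
  · have hcases : ∀ i, 0 < perturbCurve a b r f ψ s ε i →
        (a ≤ i ∧ i ≤ b) ∨ (i + 1 = a ∧ 0 < s ∧ perturbCurve a b r f ψ s ε i = s * ε) := by
      intro i hi
      by_cases hab : a ≤ i ∧ i ≤ b
      · exact Or.inl hab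
      · rw [perturbCurve, if_neg hab] at hi ⊢
        split_ifs at hi ⊢ with h
        · exact Or.inr ⟨h, (pos_iff_pos_of_mul_pos hi).2 hε, rfl⟩
        · exact absurd hi (lt_irrefl _)
    intro i l k hil hlk hkB hi hk
    rcases hil.eq_or_lt with rfl | hil
    · exact ⟨hi, by linarith⟩
    rcases hlk.eq_or_lt with rfl | hlk
    · exact ⟨hk, by linarith⟩
    have hk' : a ≤ k ∧ k ≤ b := by
      rcases hcases k hk with h | ⟨h, -⟩
      · exact h
      · rcases hcases i hi with h' | ⟨h', -⟩ <;> omega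
    obtain ⟨hk1, hk2⟩ := hin k hk'.1 hk'.2
    have hl' : a ≤ l ∧ l ≤ b := by
      rcases hcases i hi with h' | ⟨h', -⟩ <;> omega
    obtain ⟨hl1, hl2⟩ := hin l hl'.1 hl'.2
    refine ⟨hl1, ?_⟩
    rw [hk2, hl2]
    rcases hcases i hi with hi' | ⟨hi', hs', hie⟩
    · obtain ⟨hi1, hi2⟩ := hin i hi'.1 hi'.2
      rw [hi2]
      have c1 := hconv i l k hi'.1 hil.le hlk.le hk'.2
      have c2 := mul_le_mul_of_nonneg_left (hψ i l k hi'.1 hil.le hlk.le hk'.2) hε.le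
      simp only at c1
      linarith
    · rw [hie]
      have hbd := h2 l (Finset.mem_Icc.2 hl') hs'
      have hlpos := h1 l (Finset.mem_Icc.2 hl')
      have hkpos := h1 k (Finset.mem_Icc.2 hk')
      have q1 : (k : ℝ) - i ≤ B := by
        have : (k : ℝ) ≤ B := by exact_mod_cast hkB
        linarith [Nat.cast_nonneg (α := ℝ) i]
      have q2 : (1 : ℝ) ≤ k - l := by
        have : (l : ℝ) + 1 ≤ k := by exact_mod_cast hlk
        linarith
      have q3 : (0 : ℝ) ≤ (l : ℝ) - i := sub_nonneg.2 (by exact_mod_cast hil.le)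
      have hX : 0 ≤ (s * ε) ^ r := by positivity
      have := mul_le_mul_of_nonneg_right q1 hlpos.le
      have := mul_le_mul_of_nonneg_right q2 hX
      have := mul_nonneg q3 hkpos.le
      linarith

lemma eventually_pos_of_hasDerivAt {F : ℝ → ℝ} {F' : ℝ} (hF : HasDerivAt F F' 0) (h0 : F 0 = 0)
    (hF' : 0 < F') : ∀ᶠ ε in 𝓝[>] (0 : ℝ), 0 < F ε := by
  have h := (hasDerivAt_iff_tendsto_slope.1 hF).mono_left
    (nhdsWithin_mono (0 : ℝ) fun x (hx : 0 < x) => (ne_of_gt hx : x ≠ 0))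
  filter_upwards [h.eventually_const_lt hF', self_mem_nhdsWithin] with ε h1 h2
  replace h2 : 0 < ε := h2
  rw [slope_def_field, h0, sub_zero, sub_zero] at h1
  exact (div_pos_iff_of_pos_right h2).1 h1

/-- First-order optimality along `perturbDir`. -/
lemma TailMaximal.variation {a b B j : ℕ} {r m T : ℝ} {f ψ : ℕ → ℝ} {s : ℝ}
    (hmax : TailMaximal B j r m T) (hr : r < 0) (hab : a ≤ b)
    (hbB : b ≤ B) (hpos : ∀ i, a ≤ i → i ≤ b → 0 < f i) (hz : ∀ i, ¬ (a ≤ i ∧ i ≤ b) → f i = 0)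
    (hconv : SeqConvexOn a b (fun i => f i ^ r)) (hψ : SeqConvexOn a b ψ) (hs : 0 ≤ s)
    (hf : ∑ i ∈ Finset.range (B + 1), ((i : ℝ) - m) * f i ≤ 0)
    (hT : ∑ i ∈ Finset.range (B + 1), tailWeight j T i * f i = 0)
    (hneg : ∑ i ∈ Finset.range (B + 1), ((i : ℝ) - m) * f i < 0 ∨
      ∑ i ∈ Finset.range (B + 1), ((i : ℝ) - m) * perturbDir a b r f ψ s i < 0) :
    ∑ i ∈ Finset.range (B + 1), tailWeight j T i * perturbDir a b r f ψ s i ≤ 0 := by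
  by_contra! hgt
  have hder : ∀ u : ℕ → ℝ, HasDerivAt
      (fun ε => ∑ i ∈ Finset.range (B + 1), u i * perturbCurve a b r f ψ s ε i)
      (∑ i ∈ Finset.range (B + 1), u i * perturbDir a b r f ψ s i) 0 := fun u =>
    HasDerivAt.fun_sum fun i _ => (hasDerivAt_perturbCurve s hpos i).const_mul (u i)
  have hzero : ∀ i, perturbCurve a b r f ψ s 0 i = f i := perturbCurve_zero s hr hpos hz
  have e1 := eventually_pos_of_hasDerivAt (hder (tailWeight j T)) (by simpa [hzero] using hT) hgt
  have e2 : ∀ᶠ ε in 𝓝[>] (0 : ℝ),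
      ∑ i ∈ Finset.range (B + 1), ((i : ℝ) - m) * perturbCurve a b r f ψ s ε i ≤ 0 := by
    have hd := hder fun i => (i : ℝ) - m
    rcases hf.eq_or_lt with h | h
    · rcases hneg with h' | h'
      · exact absurd h h'.ne
      have := eventually_pos_of_hasDerivAt hd.neg (by simpa [hzero] using h) (neg_pos.2 h')
      filter_upwards [this] with ε hε
      exact (neg_pos.1 hε).le
    · have hc := hd.continuousAt.tendsto.mono_left (nhdsWithin_le_nhds (s := Set.Ioi 0))
      simp only [hzero] at hc
      filter_upwards [hc.eventually_lt_const h] with ε hε using hε.le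
  obtain ⟨ε, h1, h2, h3, h4⟩ := (e1.and (e2.and
    (eventually_rConcave_perturbCurve hr hpos hconv hψ hs))).exists
  refine absurd (hmax _ h3 (fun i hi => ?_) h4 h2) (not_le.2 h1)
  rw [perturbCurve, if_neg (by omega), if_neg (by omega)]

/-- A monotone weight that increases strictly at `j` cannot be orthogonal to all affine
sequences. -/
lemma not_orthogonal_affine_of_monotone {a b j : ℕ} {p w : ℕ → ℝ} (haj : a < j) (hjb : j ≤ b)
    (hp : ∀ i, a ≤ i → i ≤ b → 0 < p i) (hw : Monotone w) (hwj : w (j - 1) < w j)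
    (h0 : ∑ i ∈ Finset.Icc a b, w i * p i = 0)
    (h1 : ∑ i ∈ Finset.Icc a b, w i * (p i * i) = 0) : False := by
  set P := ∑ i ∈ Finset.Icc a b, p i with hP
  set Q := ∑ i ∈ Finset.Icc a b, p i * i with hQ
  have hp' : ∀ i ∈ Finset.Icc a b, 0 < p i := fun i hi =>
    hp i (Finset.mem_Icc.1 hi).1 (Finset.mem_Icc.1 hi).2
  have hP0 : 0 < P := Finset.sum_pos hp' ⟨j, Finset.mem_Icc.2 ⟨haj.le, hjb⟩⟩
  have hQ0 : 0 ≤ Q := Finset.sum_nonneg fun i hi => mul_nonneg (hp' i hi).le i.cast_nonneg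
  set c := Q / P with hc
  have hcP : c * P = Q := div_mul_cancel₀ _ hP0.ne'
  set k := ⌊c⌋₊ with hk
  have hkc : (k : ℝ) ≤ c := Nat.floor_le (div_nonneg hQ0 hP0.le)
  have hck : c < k + 1 := Nat.lt_floor_add_one c
  have hle : ∀ i : ℕ, i ≤ k → (i : ℝ) ≤ c := fun i hi =>
    (by exact_mod_cast hi : (i : ℝ) ≤ k).trans hkc
  have hlt : ∀ i : ℕ, k < i → c < i := fun i hi =>
    hck.trans_le (by exact_mod_cast hi)
  have hsum : ∑ i ∈ Finset.Icc a b, (w i - w k) * (p i * (i - c)) = 0 := by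
    have : ∑ i ∈ Finset.Icc a b, (w i - w k) * (p i * (i - c)) =
        ∑ i ∈ Finset.Icc a b, w i * (p i * i) - c * ∑ i ∈ Finset.Icc a b, w i * p i
          - w k * Q + w k * c * P := by
      simp only [hP, hQ, Finset.mul_sum, ← Finset.sum_sub_distrib, ← Finset.sum_add_distrib]
      exact Finset.sum_congr rfl fun i _ => by ring
    rw [this, h0, h1, ← hcP]; ring
  have hnn : ∀ i ∈ Finset.Icc a b, 0 ≤ (w i - w k) * (p i * (i - c)) := by
    intro i hi
    have := hp' i hi
    rcases le_or_gt i k with h | h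
    · exact mul_nonneg_of_nonpos_of_nonpos (sub_nonpos.2 (hw h))
        (mul_nonpos_of_nonneg_of_nonpos this.le (sub_nonpos.2 (hle i h)))
    · exact mul_nonneg (sub_nonneg.2 (hw h.le))
        (mul_nonneg this.le (sub_nonneg.2 (hlt i h).le))
  have hall := (Finset.sum_eq_zero_iff_of_nonneg hnn).1 hsum
  rcases le_or_gt j k with h | h
  · have hm : j - 1 ∈ Finset.Icc a b := Finset.mem_Icc.2 ⟨by omega, by omega⟩
    refine absurd (hall _ hm) (ne_of_gt ?_)
    have hc' : ((j - 1 : ℕ) : ℝ) < c :=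
      (by exact_mod_cast (by omega : j - 1 < k) : ((j - 1 : ℕ) : ℝ) < k).trans_le hkc
    exact mul_pos_of_neg_of_neg (sub_neg.2 (hwj.trans_le (hw h)))
      (mul_neg_of_pos_of_neg (hp' _ hm) (sub_neg.2 hc'))
  · have hm : j ∈ Finset.Icc a b := Finset.mem_Icc.2 ⟨haj.le, hjb⟩
    refine absurd (hall _ hm) (ne_of_gt ?_)
    exact mul_pos (sub_pos.2 ((hw (by omega : k ≤ j - 1)).trans_lt hwj))
      (mul_pos (hp' _ hm) (sub_pos.2 (hlt j h)))

/-- Complementary slackness: a convex sequence orthogonal to the optimal weights is affine away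
from the right end point, and the support starts at `0`. -/
lemma affine_of_orthogonal {a b j : ℕ} {p w φ : ℕ → ℝ} {β m T : ℝ} (haj : a < j) (hjb : j ≤ b)
    (hp : ∀ i, a ≤ i → i ≤ b → 0 < p i)
    (hw : ∀ i, w i = tailWeight j T i - β * ((i : ℝ) - m))
    (h0 : ∑ i ∈ Finset.Icc a b, w i * p i = 0)
    (h1 : ∑ i ∈ Finset.Icc a b, w i * (p i * i) = 0)
    (hwb : 0 ≤ w b) (hwa : a ≠ 0 → w (a - 1) ≤ 0) (hφ : SeqConvexOn a b φ)
    (hφ0 : ∑ i ∈ Finset.Icc a b, w i * (p i * φ i) = 0) :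
    a = 0 ∧ ∃ x y : ℝ, ∀ i < b, φ i = x + y * i := by
  have hp' : ∀ i ∈ Finset.Icc a b, 0 < p i := fun i hi =>
    hp i (Finset.mem_Icc.1 hi).1 (Finset.mem_Icc.1 hi).2
  have hβ : 0 < β := by
    by_contra! hβ
    have hmono : ∀ i k : ℕ, i ≤ k → - (β * ((i : ℝ) - m)) ≤ - (β * ((k : ℝ) - m)) := by
      intro i k hik
      have : (i : ℝ) ≤ k := by exact_mod_cast hik
      nlinarith
    refine not_orthogonal_affine_of_monotone haj hjb hp (fun i k hik => ?_) ?_ h0 h1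
    · have := hmono i k hik
      rw [hw, hw]
      unfold tailWeight
      split_ifs <;> first | omega | linarith
    · have := hmono (j - 1) j (by omega)
      rw [hw, hw, tailWeight, tailWeight, if_pos le_rfl, if_neg (by omega)]
      linarith
  have hanti1 : ∀ i k : ℕ, i < k → k < j → w k < w i := by
    intro i k hik hk
    have : (i : ℝ) < k := by exact_mod_cast hik
    rw [hw, hw, tailWeight, tailWeight, if_neg (by omega), if_neg (by omega)]
    nlinarith
  have hanti2 : ∀ i k : ℕ, j ≤ i → i < k → w k < w i := by
    intro i k hi hik
    have : (i : ℝ) < k := by exact_mod_cast hik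
    rw [hw, hw, tailWeight, tailWeight, if_pos (by omega), if_pos (by omega)]
    nlinarith
  have hright : ∀ i, j ≤ i → i ≤ b → 0 ≤ w i := by
    intro i hi hib
    rcases hib.eq_or_lt with rfl | h
    · exact hwb
    · exact hwb.trans (hanti2 i b hi h).le
  have hzero : w a ≤ 0 → ∀ i, a ≤ i → i ≤ b → w i = 0 := by
    intro hwa0 i hai hib
    have hle : ∀ i, a ≤ i → i < j → w i ≤ 0 := by
      intro i hi hij
      rcases hi.eq_or_lt with rfl | h
      · exact hwa0
      · exact (hanti1 a i h hij).le.trans hwa0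
    have hsum : ∑ i ∈ Finset.Icc a b, w i * (p i * (i - (j - 1 / 2))) = 0 := by
      have : ∑ i ∈ Finset.Icc a b, w i * (p i * ((i : ℝ) - (j - 1 / 2))) =
          ∑ i ∈ Finset.Icc a b, w i * (p i * i) -
            ((j : ℝ) - 1 / 2) * ∑ i ∈ Finset.Icc a b, w i * p i := by
        simp only [Finset.mul_sum, ← Finset.sum_sub_distrib]
        exact Finset.sum_congr rfl fun i _ => by ring
      rw [this, h0, h1]; ring
    have hoff : ∀ i : ℕ, i < j → (i : ℝ) - (j - 1 / 2) < 0 := fun i h => by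
      have : (i : ℝ) + 1 ≤ j := by exact_mod_cast h
      linarith
    have hoff' : ∀ i : ℕ, j ≤ i → 0 < (i : ℝ) - (j - 1 / 2) := fun i h => by
      have : (j : ℝ) ≤ i := by exact_mod_cast h
      linarith
    have hnn : ∀ i ∈ Finset.Icc a b, 0 ≤ w i * (p i * ((i : ℝ) - (j - 1 / 2))) := by
      intro i hi
      have hpi := hp' i hi
      rw [Finset.mem_Icc] at hi
      rcases lt_or_ge i j with h | h
      · exact mul_nonneg_of_nonpos_of_nonpos (hle i hi.1 h)
          (mul_nonpos_of_nonneg_of_nonpos hpi.le (hoff i h).le)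
      · exact mul_nonneg (hright i h hi.2) (mul_nonneg hpi.le (hoff' i h).le)
    have hi := (Finset.sum_eq_zero_iff_of_nonneg hnn).1 hsum i (Finset.mem_Icc.2 ⟨hai, hib⟩)
    refine (mul_eq_zero.1 hi).resolve_right (mul_ne_zero (hp i hai hib).ne' ?_)
    rcases lt_or_ge i j with h | h
    · exact (hoff i h).ne
    · exact (hoff' i h).ne'
  have ha0 : a = 0 := by
    by_contra ha
    have h := (hanti1 (a - 1) a (by omega) haj).trans_le (hwa ha)
    exact h.ne (hzero h.le a le_rfl (by omega))
  subst ha0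
  refine ⟨rfl, ?_⟩
  rcases le_or_gt (w 0) 0 with hw0 | hw0
  · have hz := hzero hw0
    have hj1 : j = 1 := by
      by_contra hj
      have := hanti1 0 1 (by omega) (by omega)
      rw [hz 0 le_rfl (by omega), hz 1 (by omega) (by omega)] at this
      exact lt_irrefl _ this
    have hb1 : b = j := by
      by_contra hb
      have := hanti2 j b le_rfl (by omega)
      rw [hz j (by omega) hjb, hz b (by omega) le_rfl] at this
      exact lt_irrefl _ this
    refine ⟨φ 0, 0, fun i hi => ?_⟩
    obtain rfl : i = 0 := by omega
    simp
  have hd : w (j - 1) < 0 := by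
    by_contra! hd
    have hnn : ∀ i ∈ Finset.Icc 0 b, 0 ≤ w i * p i := by
      intro i hi
      refine mul_nonneg ?_ (hp' i hi).le
      rw [Finset.mem_Icc] at hi
      rcases lt_trichotomy i (j - 1) with h | rfl | h
      · exact hd.trans (hanti1 i (j - 1) h (by omega)).le
      · exact hd
      · exact hright i (by omega) hi.2
    have := (Finset.sum_eq_zero_iff_of_nonneg hnn).1 h0 0 (by simp)
    exact (mul_pos hw0 (hp 0 le_rfl (by omega))).ne' this
  obtain ⟨k, hkd, hwk, hkmax⟩ : ∃ k, k < j - 1 ∧ 0 ≤ w k ∧ ∀ i, k < i → i < j → w i < 0 := by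
    classical
    have hk := Nat.findGreatest_spec (P := fun i => 0 ≤ w i) (Nat.zero_le (j - 1)) hw0.le
    refine ⟨Nat.findGreatest (fun i => 0 ≤ w i) (j - 1), ?_, hk, fun i hi hij =>
      not_le.1 (Nat.findGreatest_is_greatest hi (by omega))⟩
    refine lt_of_le_of_ne (Nat.findGreatest_le _) fun h => ?_
    rw [h] at hk
    exact absurd hd (not_lt.2 hk)
  set d := j - 1 with hdj
  have hdk : (0 : ℝ) < d - k := sub_pos.2 (by exact_mod_cast hkd)
  let θ : ℕ → ℝ := fun i => ((d : ℝ) - k) * φ i - (((d : ℝ) - i) * φ k + ((i : ℝ) - k) * φ d)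
  have hsum : ∑ i ∈ Finset.Icc 0 b, w i * (p i * θ i) = 0 := by
    have : ∑ i ∈ Finset.Icc 0 b, w i * (p i * θ i) =
        ((d : ℝ) - k) * ∑ i ∈ Finset.Icc 0 b, w i * (p i * φ i)
          - (d * φ k - k * φ d) * ∑ i ∈ Finset.Icc 0 b, w i * p i
          - (φ d - φ k) * ∑ i ∈ Finset.Icc 0 b, w i * (p i * i) := by
      simp only [θ, Finset.mul_sum, ← Finset.sum_sub_distrib]
      exact Finset.sum_congr rfl fun i _ => by ring
    rw [this, h0, h1, hφ0]; ring
  have hθout : ∀ i ≤ b, i ≤ k ∨ d ≤ i → 0 ≤ θ i := by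
    intro i hib hi
    rcases hi with hi | hi
    · have := hφ i k d (Nat.zero_le _) hi hkd.le (by omega)
      simp only [θ]; linarith
    · have := hφ k d i (Nat.zero_le _) hkd.le hi hib
      simp only [θ]; linarith
  have hθin : ∀ i, k ≤ i → i ≤ d → θ i ≤ 0 := by
    intro i hki hid
    have := hφ k i d (Nat.zero_le _) hki hid (by omega)
    simp only [θ]; linarith
  have hnn : ∀ i ∈ Finset.Icc 0 b, 0 ≤ w i * (p i * θ i) := by
    intro i hi
    have hpi := hp' i hi
    rw [Finset.mem_Icc] at hi
    rcases le_or_gt i k with h | h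
    · have hwi : 0 ≤ w i := by
        rcases h.eq_or_lt with rfl | h
        · exact hwk
        · exact hwk.trans (hanti1 i k h (by omega)).le
      exact mul_nonneg hwi (mul_nonneg hpi.le (hθout i hi.2 (Or.inl h)))
    rcases lt_or_ge i j with h' | h'
    · exact mul_nonneg_of_nonpos_of_nonpos (hkmax i h h').le
        (mul_nonpos_of_nonneg_of_nonpos hpi.le (hθin i h.le (by omega)))
    · exact mul_nonneg (hright i h' hi.2)
        (mul_nonneg hpi.le (hθout i hi.2 (Or.inr (by omega))))
  have hall := (Finset.sum_eq_zero_iff_of_nonneg hnn).1 hsum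
  have hθ0 : ∀ i < b, θ i = 0 := by
    intro i hib
    by_cases hik : i = k
    · subst hik; simp only [θ]; ring
    have hwi : w i ≠ 0 := by
      rcases lt_or_gt_of_ne hik with h | h
      · exact (hwk.trans_lt (hanti1 i k h (by omega))).ne'
      rcases lt_or_ge i j with h' | h'
      · exact (hkmax i h h').ne
      · exact (hwb.trans_lt (hanti2 i b h' hib)).ne'
    have := hall i (Finset.mem_Icc.2 ⟨Nat.zero_le _, hib.le⟩)
    simpa [hwi, (hp i (Nat.zero_le _) hib.le).ne'] using this
  refine ⟨(d * φ k - k * φ d) / (d - k), (φ d - φ k) / (d - k), fun i hi => ?_⟩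
  have := hθ0 i hi
  simp only [θ] at this
  field_simp
  linarith

lemma sum_mul_perturbDir {a b B : ℕ} (r : ℝ) (f ψ u : ℕ → ℝ) {s : ℝ} (hab : a ≤ b) (hbB : b ≤ B)
    (hs : a = 0 → s = 0) :
    ∑ i ∈ Finset.range (B + 1), u i * perturbDir a b r f ψ s i =
      1 / r * ∑ i ∈ Finset.Icc a b, u i * ((f i ^ r) ^ (1 / r - 1) * ψ i) + s * u (a - 1) := by
  have hsplit : ∀ i, u i * perturbDir a b r f ψ s i =
      (if a ≤ i ∧ i ≤ b then 1 / r * (u i * ((f i ^ r) ^ (1 / r - 1) * ψ i)) else 0) +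
        if i = a - 1 then s * u (a - 1) else 0 := by
    intro i
    unfold perturbDir
    rcases Nat.eq_zero_or_pos a with ha | ha
    · rw [hs ha]
      split_ifs <;> first | omega | ring
    · split_ifs with h1 h2 h3 h4
      · omega
      · ring
      · subst h4; ring
      · omega
      · omega
      · ring
  have hI : Finset.Icc a b = (Finset.range (B + 1)).filter (fun i => a ≤ i ∧ i ≤ b) := by
    ext i; simp; omega
  rw [Finset.sum_congr rfl fun i _ => hsplit i, Finset.sum_add_distrib, ← Finset.sum_filter, ← hI,
    Finset.sum_ite_eq', if_pos (by simp; omega), Finset.mul_sum]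

lemma perturbDir_add_mul (a b : ℕ) (r : ℝ) (f ψ χ : ℕ → ℝ) (s κ : ℝ) (i : ℕ) :
    perturbDir a b r f (fun i => ψ i + κ * χ i) s i =
      perturbDir a b r f ψ s i + κ * perturbDir a b r f χ 0 i := by
  unfold perturbDir
  split_ifs <;> ring

lemma SeqConvexOn.add_affine {a b : ℕ} {ψ : ℕ → ℝ} (hψ : SeqConvexOn a b ψ) (κ c : ℝ) :
    SeqConvexOn a b (fun i => ψ i + κ * (c - i)) := by
  intro i l k hi hil hlk hk
  have := hψ i l k hi hil hlk hk
  simp only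
  linarith

/-- A Lagrange multiplier for the mean constraint, which is active. -/
lemma TailMaximal.exists_multiplier {a b B j : ℕ} {r m T : ℝ} {f : ℕ → ℝ}
    (hmax : TailMaximal B j r m T) (hr : r < 0) (haj : a < j) (hjb : j ≤ b)
    (hbB : b ≤ B) (hpos : ∀ i, a ≤ i → i ≤ b → 0 < f i) (hz : ∀ i, ¬ (a ≤ i ∧ i ≤ b) → f i = 0)
    (hconv : SeqConvexOn a b (fun i => f i ^ r)) (hmj : m < j) (hT0 : 0 < T) (hT1 : T ≤ 1)
    (hf : ∑ i ∈ Finset.range (B + 1), ((i : ℝ) - m) * f i ≤ 0)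
    (hT : ∑ i ∈ Finset.range (B + 1), tailWeight j T i * f i = 0) :
    ∑ i ∈ Finset.range (B + 1), ((i : ℝ) - m) * f i = 0 ∧
      ∃ β : ℝ, ∀ (ψ : ℕ → ℝ) (s : ℝ), SeqConvexOn a b ψ → 0 ≤ s →
        ∑ i ∈ Finset.range (B + 1),
          (tailWeight j T i - β * ((i : ℝ) - m)) * perturbDir a b r f ψ s i ≤ 0 := by
  have hab : a ≤ b := by omega
  have hp : ∀ i, a ≤ i → i ≤ b → 0 < -(1 / r) * (f i ^ r) ^ (1 / r - 1) := fun i h1 h2 =>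
    mul_pos (neg_pos.2 (one_div_neg.2 hr))
      (Real.rpow_pos_of_pos (Real.rpow_pos_of_pos (hpos i h1 h2) _) _)
  have hsum : ∀ (u : ℕ → ℝ) (c : ℝ), (∀ i, a ≤ i → i ≤ b → 0 ≤ u i * ((i : ℝ) - c)) →
      (∃ i, a ≤ i ∧ i ≤ b ∧ 0 < u i * ((i : ℝ) - c)) →
      0 < ∑ i ∈ Finset.range (B + 1), u i * perturbDir a b r f (fun i => c - i) 0 i := by
    rintro u c hnn ⟨i, h1, h2, hi⟩
    have hterm : ∀ i, a ≤ i → i ≤ b → u i * perturbDir a b r f (fun i => c - i) 0 i =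
        (-(1 / r) * (f i ^ r) ^ (1 / r - 1)) * (u i * ((i : ℝ) - c)) := fun i h1 h2 => by
      rw [perturbDir, if_pos ⟨h1, h2⟩]; ring
    refine Finset.sum_pos' (fun k _ => ?_) ⟨i, by simp; omega, ?_⟩
    · by_cases hk : a ≤ k ∧ k ≤ b
      · rw [hterm k hk.1 hk.2]
        exact mul_nonneg (hp k hk.1 hk.2).le (hnn k hk.1 hk.2)
      · simp [perturbDir, hk]
    · rw [hterm i h1 h2]
      exact mul_pos (hp i h1 h2) hi
  have hzc : SeqConvexOn a b (fun _ => 0) := fun i l k _ _ _ _ => by simp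
  have htight : ∑ i ∈ Finset.range (B + 1), ((i : ℝ) - m) * f i = 0 := by
    refine hf.eq_or_lt.resolve_right fun hlt => ?_
    have hc : SeqConvexOn a b (fun i => ((j : ℝ) - 1 / 2) - i) := by
      simpa using hzc.add_affine 1 ((j : ℝ) - 1 / 2)
    refine absurd (hmax.variation hr hab hbB hpos hz hconv hc le_rfl hf hT (Or.inl hlt))
      (not_le.2 (hsum _ _ (fun i _ _ => ?_) ⟨a, le_rfl, hab, ?_⟩))
    · unfold tailWeight
      split_ifs with h
      · have : (j : ℝ) ≤ i := by exact_mod_cast h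
        exact mul_nonneg (by linarith) (by linarith)
      · have : (i : ℝ) + 1 ≤ j := by exact_mod_cast (not_le.1 h)
        exact mul_nonneg_of_nonpos_of_nonpos (by linarith) (by linarith)
    · have : (a : ℝ) + 1 ≤ j := by exact_mod_cast haj
      rw [tailWeight, if_neg (by omega)]
      exact mul_pos_of_neg_of_neg (by linarith) (by linarith)
  refine ⟨htight, ?_⟩
  set M := ∑ i ∈ Finset.range (B + 1), ((i : ℝ) - m) * perturbDir a b r f (fun i => m - i) 0 i
    with hM
  set N := ∑ i ∈ Finset.range (B + 1), tailWeight j T i * perturbDir a b r f (fun i => m - i) 0 i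
    with hN
  have hM0 : 0 < M := hsum (fun i => (i : ℝ) - m) m (fun i _ _ => mul_self_nonneg _)
    ⟨j, haj.le, hjb, mul_self_pos.2 (sub_pos.2 hmj).ne'⟩
  refine ⟨N / M, fun ψ s hψ hs => ?_⟩
  by_contra! hγ
  set γ := ∑ i ∈ Finset.range (B + 1),
    (tailWeight j T i - N / M * ((i : ℝ) - m)) * perturbDir a b r f ψ s i with hγd
  set X := ∑ i ∈ Finset.range (B + 1), ((i : ℝ) - m) * perturbDir a b r f ψ s i with hX
  set Y := ∑ i ∈ Finset.range (B + 1), tailWeight j T i * perturbDir a b r f ψ s i with hY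
  have hγXY : γ = Y - N / M * X := by
    simp only [hγd, hX, hY, Finset.mul_sum, ← Finset.sum_sub_distrib]
    exact Finset.sum_congr rfl fun i _ => by ring
  set τ := γ / (2 * (|N| + 1)) with hτ
  have hN1 : 0 < 2 * (|N| + 1) := by positivity
  have hτ0 : 0 < τ := div_pos hγ hN1
  have hτN : τ * N < γ := by
    have h1 : τ * (2 * (|N| + 1)) = γ := div_mul_cancel₀ _ hN1.ne'
    nlinarith [le_abs_self N, abs_nonneg N]
  set κ := -(X / M) - τ with hκ
  have hlin : ∀ u : ℕ → ℝ, ∑ i ∈ Finset.range (B + 1),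
      u i * perturbDir a b r f (fun i => ψ i + κ * (m - i)) s i =
      ∑ i ∈ Finset.range (B + 1), u i * perturbDir a b r f ψ s i +
        κ * ∑ i ∈ Finset.range (B + 1), u i * perturbDir a b r f (fun i => m - i) 0 i := by
    intro u
    rw [Finset.mul_sum, ← Finset.sum_add_distrib]
    refine Finset.sum_congr rfl fun i _ => ?_
    rw [perturbDir_add_mul a b r f ψ (fun i => m - i)]
    ring
  have hvar := hmax.variation hr hab hbB hpos hz hconv (hψ.add_affine κ m) hs hf hT (Or.inr (by
    rw [hlin, ← hX, ← hM]
    have : X + κ * M = -(τ * M) := by rw [hκ]; field_simp; ring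
    rw [this]
    exact neg_neg_of_pos (mul_pos hτ0 hM0)))
  rw [hlin, ← hY, ← hN] at hvar
  have : Y + κ * N = γ - τ * N := by rw [hγXY, hκ]; ring
  linarith

/-- A maximiser has support starting at `0`, and its `r`-th power is affine away from the largest
support point. -/
lemma TailMaximal.affine {a b B j : ℕ} {r m T : ℝ} {f : ℕ → ℝ}
    (hmax : TailMaximal B j r m T) (hr : r < 0) (haj : a < j) (hjb : j ≤ b)
    (hbB : b ≤ B) (hpos : ∀ i, a ≤ i → i ≤ b → 0 < f i) (hz : ∀ i, ¬ (a ≤ i ∧ i ≤ b) → f i = 0)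
    (hconv : SeqConvexOn a b (fun i => f i ^ r)) (hmj : m < j) (hT0 : 0 < T) (hT1 : T ≤ 1)
    (hf : ∑ i ∈ Finset.range (B + 1), ((i : ℝ) - m) * f i ≤ 0)
    (hT : ∑ i ∈ Finset.range (B + 1), tailWeight j T i * f i = 0) :
    a = 0 ∧ ∃ x y : ℝ, ∀ i < b, f i ^ r = x + y * i := by
  obtain ⟨htight, β, hβ⟩ := hmax.exists_multiplier hr haj hjb hbB hpos hz hconv hmj hT0 hT1 hf hT
  have hab : a ≤ b := by omega
  have hr' : 1 / r < 0 := one_div_neg.2 hr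
  set w : ℕ → ℝ := fun i => tailWeight j T i - β * ((i : ℝ) - m) with hw
  have hp : ∀ i, a ≤ i → i ≤ b → 0 < (f i ^ r) ^ (1 / r - 1) := fun i h1 h2 =>
    Real.rpow_pos_of_pos (Real.rpow_pos_of_pos (hpos i h1 h2) _) _
  have hvar : ∀ ψ : ℕ → ℝ, SeqConvexOn a b ψ →
      0 ≤ ∑ i ∈ Finset.Icc a b, w i * ((f i ^ r) ^ (1 / r - 1) * ψ i) := by
    intro ψ hψ
    have h := hβ ψ 0 hψ le_rfl
    rw [sum_mul_perturbDir r f ψ w hab hbB fun _ => rfl, zero_mul, add_zero] at h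
    exact nonneg_of_mul_nonpos_right h hr'
  have haff : ∀ x y : ℝ, SeqConvexOn a b (fun i => x + y * i) := fun x y i l k _ _ _ _ => by
    simp only; linarith
  have h0 : ∑ i ∈ Finset.Icc a b, w i * (f i ^ r) ^ (1 / r - 1) = 0 := by
    have h1 := hvar _ (haff 1 0)
    have h2 := hvar _ (haff (-1) 0)
    simp only [zero_mul, add_zero, mul_one, mul_neg, Finset.sum_neg_distrib] at h1 h2
    linarith
  have h1 : ∑ i ∈ Finset.Icc a b, w i * ((f i ^ r) ^ (1 / r - 1) * i) = 0 := by
    have h1 := hvar _ (haff 0 1)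
    have h2 := hvar _ (haff 0 (-1))
    simp only [zero_add, one_mul, neg_mul, mul_neg, Finset.sum_neg_distrib] at h1 h2
    linarith
  have hwb : 0 ≤ w b := by
    have h := hvar (fun i => if i = b then 1 else 0) (by
      intro i l k hai hil hlk hkb
      have h1 : (i : ℝ) ≤ l := by exact_mod_cast hil
      have h2 : (l : ℝ) ≤ k := by exact_mod_cast hlk
      by_cases hl : l = b
      · obtain rfl : k = l := by omega
        simp only [if_pos hl]
        split_ifs <;> linarith
      · simp only [if_neg hl, mul_zero]
        split_ifs <;> simp <;> linarith)
    simp only [mul_ite, mul_one, mul_zero, Finset.sum_ite_eq', Finset.mem_Icc, hab, le_refl,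
      and_self, if_true] at h
    exact nonneg_of_mul_nonneg_left h (hp b hab le_rfl)
  have hwa : a ≠ 0 → w (a - 1) ≤ 0 := by
    intro ha
    have h := hβ (fun i => 0 + 0 * i) 1 (haff 0 0) zero_le_one
    rw [sum_mul_perturbDir r f _ w hab hbB fun h => absurd h ha] at h
    simpa using h
  have hφ0 : ∑ i ∈ Finset.Icc a b, w i * ((f i ^ r) ^ (1 / r - 1) * f i ^ r) = 0 := by
    have hI : Finset.Icc a b ⊆ Finset.range (B + 1) := fun i hi => by
      simp at hi ⊢; omega
    have : ∑ i ∈ Finset.Icc a b, w i * ((f i ^ r) ^ (1 / r - 1) * f i ^ r) =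
        ∑ i ∈ Finset.range (B + 1), w i * f i := by
      rw [← Finset.sum_subset hI fun i _ hi => by
        rw [hz i (by simpa using hi), mul_zero]]
      refine Finset.sum_congr rfl fun i hi => ?_
      rw [Finset.mem_Icc] at hi
      have hfi := hpos i hi.1 hi.2
      have hc := Real.rpow_pos_of_pos hfi r
      rw [Real.rpow_sub_one hc.ne', div_mul_cancel₀ _ hc.ne', one_div,
        Real.rpow_rpow_inv hfi.le hr.ne]
    rw [this]
    simp only [hw, sub_mul, mul_assoc, Finset.sum_sub_distrib, ← Finset.mul_sum] at hT htight ⊢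
    rw [hT, htight]; ring
  exact affine_of_orthogonal haj hjb hp (fun i => rfl) h0 h1 hwb hwa hconv hφ0

/-- Proposition 5(ii) of Shah & Samworth (2013): for a maximiser `f` of the tail
probability over the mean-constrained `r`-concave class, with `iM` the largest
support point, `f_i > 0` for all `i ≤ iM - 1` and `(f_i)^r` is affine in `i` on
`{0, 1, ..., iM - 1}`:
`(iM - 1) (f_i)^r = (iM - 1 - i) (f_0)^r + i (f_{iM-1})^r`. -/
theorem rConcave_maximiser_linear (B : ℕ) (hB : 1 ≤ B) (r : ℝ) (hr : r < 0)
    (η : ℝ) (hη : 0 < η) (j : ℕ) (hj1 : 1 ≤ j) (hjB : j ≤ B) (hηt : η < (j : ℝ) / B)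
    (f : ℕ → ℝ) (hf : LatticePMF B f) (hfr : RConcavePMF B r f) (hfm : pmfMean B f ≤ η)
    (hmax : ∀ g : ℕ → ℝ, LatticePMF B g → RConcavePMF B r g → pmfMean B g ≤ η →
      pmfTail B j g ≤ pmfTail B j f)
    (iM : ℕ) (hiMpos : 0 < f iM) (hiMmax : ∀ i, 0 < f i → i ≤ iM) :
    (∀ i, i + 1 ≤ iM → 0 < f i) ∧
    (∀ i, i + 1 ≤ iM →
      ((iM : ℝ) - 1) * f i ^ r =
        ((iM : ℝ) - 1 - i) * f 0 ^ r + (i : ℝ) * f (iM - 1) ^ r) := by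
  have hB0 : (0 : ℝ) < B := by positivity
  obtain ⟨hf0, hfz, hf1⟩ := hf
  have hmj : (B : ℝ) * η < j := by rwa [lt_div_iff₀ hB0, mul_comm] at hηt
  have hmax' := tailMaximal_of_isMax hB hmax
  have hiMB : iM ≤ B := not_lt.1 fun h => hiMpos.ne' (hfz iM h)
  have hT0 : 0 < pmfTail B j f :=
    hmax'.pos hr (mul_pos hB0 hη) hjB (Finset.sum_nonneg fun i _ => hf0 i)
  have hT1 : pmfTail B j f ≤ 1 := by
    rw [← hf1]
    refine Finset.sum_le_sum_of_subset_of_nonneg (fun i hi => ?_) fun i _ _ => hf0 i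
    simp at hi ⊢; omega
  have hT : ∑ i ∈ Finset.range (B + 1), tailWeight j (pmfTail B j f) i * f i = 0 := by
    rw [sum_tailWeight_mul, hf1]; ring
  have hm : ∑ i ∈ Finset.range (B + 1), ((i : ℝ) - B * η) * f i ≤ 0 := by
    rw [sum_sub_mul B hB, hf1]
    exact mul_nonpos_of_nonneg_of_nonpos hB0.le (by linarith)
  have hjM : j ≤ iM := by
    by_contra! h
    refine hT0.ne' (Finset.sum_eq_zero fun i hi => ?_)
    rw [Finset.mem_Icc] at hi
    refine ((hf0 i).eq_or_lt.resolve_right fun hi' => ?_).symm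
    have := hiMmax i hi'
    omega
  classical
  have hex : ∃ i, 0 < f i := ⟨iM, hiMpos⟩
  obtain ⟨a, hapos, hamin⟩ : ∃ a, 0 < f a ∧ ∀ i, 0 < f i → a ≤ i :=
    ⟨Nat.find hex, Nat.find_spec hex, fun i hi => Nat.find_min' hex hi⟩
  have hpos : ∀ i, a ≤ i → i ≤ iM → 0 < f i := fun i h1 h2 =>
    (hfr a i iM h1 h2 hiMB hapos hiMpos).1
  have hz : ∀ i, ¬ (a ≤ i ∧ i ≤ iM) → f i = 0 := fun i hi =>
    ((hf0 i).eq_or_lt.resolve_right fun h => hi ⟨hamin i h, hiMmax i h⟩).symm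
  have hconv : SeqConvexOn a iM (fun i => f i ^ r) := fun i l k hai hil hlk hk =>
    (hfr i l k hil hlk (hk.trans hiMB) (hpos i hai (hil.trans (hlk.trans hk)))
      (hpos k (hai.trans (hil.trans hlk)) hk)).2
  have haj : a < j := by
    by_contra! h
    have hlt : ∀ i, a ≤ i → 0 < (i : ℝ) - B * η := fun i hi => by
      have : (j : ℝ) ≤ i := by exact_mod_cast h.trans hi
      linarith
    refine absurd hm (not_le.2 (Finset.sum_pos' (fun i _ => ?_)
      ⟨iM, by simp; omega, mul_pos (hlt iM (hamin iM hiMpos)) hiMpos⟩))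
    by_cases hi : a ≤ i
    · exact mul_nonneg (hlt i hi).le (hf0 i)
    · rw [hz i (fun h => hi h.1), mul_zero]
  obtain ⟨rfl, x, y, hxy⟩ :=
    hmax'.affine hr haj hjM hiMB hpos hz hconv hmj hT0 hT1 hm hT
  refine ⟨fun i hi => hpos i (Nat.zero_le _) (by omega), fun i hi => ?_⟩
  rw [hxy i (by omega), hxy 0 (by omega), hxy (iM - 1) (by omega),
    Nat.cast_sub (by omega : 1 ≤ iM)]
  push_cast
  ring
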